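/- (Theorem 1(1), quantitative form: the online-branch entropy change strictly dominates the target-branch entropy change.) Let E_h = ℝ^k, E_f = ℝ^m, F = ℝ^d, C a finite nonempty index type with n elements, and δ ∈ (0,1]. Let f : E_f → F be L_f-Lipschitz and g : F → (C → ℝ) continuous linear with operator norm ‖g‖, and define the target-branch entropy G(θ_f) = H(σ(g(f(θ_f)))). Let Φ : E_h × E_f → ℝ (the online-branch objective) be differentiable with ρ-Lipschitz gradient for some ρ > 0. Consider the blockwise gradient update θ_h(t+1) = θ_h(t) − η_h · v_h and θ_f(t+1) = θ_f(t) − η_f · v_f, where (v_h, v_f) = ∇Φ(φ(t)), and set η_min = min(η_h, η_f) > 0, η_max = max(η_h, η_f), assuming η_min − ρ·η_max²/2 > 0. If both σ(g(f(θ_f(t)))) and σ(g(f(θ_f(t+1)))) have all coordinates ≥ δ and ‖∇Φ(φ(t))‖ > √n · (|log δ| + 1) · ‖g‖ · L_f · η_max / (η_min − ρ·η_max²/2), then Φ(φ(t)) − Φ(φ(t+1)) > |G(θ_f(t+1)) − G(θ_f(t))|; that is, the decrease of the online objective strictly exceeds the magnitude of the change of the target entropy. -/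

import Mathlib

open Real Finset NNReal

/-- Softmax: `σ(u) c = exp (u c) / ∑ j, exp (u j)`. -/
noncomputable def softmax {C : Type*} [Fintype C] (u : C → ℝ) : C → ℝ :=
  fun c => Real.exp (u c) / ∑ j, Real.exp (u j)

/-- Shannon entropy `H(p) = −∑ c, p c * log (p c)` (natural log, `0 * log 0 = 0`). -/
noncomputable def entropy {C : Type*} [Fintype C] (p : C → ℝ) : ℝ :=
  -∑ c, p c * Real.log (p c)

theorem abs_mul_log_sub_mul_log_le {δ x y : ℝ} (hδ : 0 < δ) (hx : δ ≤ x) (hx1 : x ≤ 1)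
    (hy : δ ≤ y) (hy1 : y ≤ 1) :
    |x * Real.log x - y * Real.log y| ≤ (|Real.log δ| + 1) * |x - y| := by
  wlog hyx : y ≤ x generalizing x y
  · rw [abs_sub_comm, abs_sub_comm x]
    exact this hy hy1 hx hx1 (le_of_not_ge hyx)
  have hy0 : 0 < y := hδ.trans_le hy
  have hx0 : 0 < x := hδ.trans_le hx
  have hlog : |Real.log x| ≤ |Real.log δ| := by
    rw [abs_of_nonpos (Real.log_nonpos hx0.le hx1),
      abs_of_nonpos (Real.log_nonpos hδ.le (hx.trans hx1))]
    exact neg_le_neg (Real.log_le_log hδ hx)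
  have hdiff : y * (Real.log x - Real.log y) ≤ x - y := by
    rw [← Real.log_div hx0.ne' hy0.ne']
    calc y * Real.log (x / y) ≤ y * (x / y - 1) := by
          gcongr
          exact Real.log_le_sub_one_of_pos (by positivity)
      _ = x - y := by field_simp
  have hdiff0 : 0 ≤ y * (Real.log x - Real.log y) :=
    mul_nonneg hy0.le (sub_nonneg.2 (Real.log_le_log hy0 hyx))
  calc |x * Real.log x - y * Real.log y|
      = |Real.log x * (x - y) + y * (Real.log x - Real.log y)| := by ring_nf
    _ ≤ |Real.log x * (x - y)| + |y * (Real.log x - Real.log y)| := abs_add_le _ _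
    _ ≤ |Real.log δ| * |x - y| + |x - y| := by
        rw [abs_mul, abs_of_nonneg hdiff0]
        exact add_le_add (by gcongr) (hdiff.trans (le_abs_self _))
    _ = (|Real.log δ| + 1) * |x - y| := by ring

theorem sq_sub_le_sub_mul_log_sub_log {x y : ℝ} (hx : 0 < x) (hx1 : x ≤ 1)
    (hy : 0 < y) (hy1 : y ≤ 1) :
    (x - y) ^ 2 ≤ (x - y) * (Real.log x - Real.log y) := by
  wlog hyx : y ≤ x generalizing x y
  · linarith [this hy hy1 hx hx1 (le_of_not_ge hyx)]
  rw [sq]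
  refine mul_le_mul_of_nonneg_left ?_ (sub_nonneg.2 hyx)
  have h := Real.one_sub_inv_le_log_of_pos (div_pos hx hy)
  rw [Real.log_div hx.ne' hy.ne', inv_div] at h
  have hxy : x - y ≤ 1 - y / x := by
    rw [one_sub_div hx.ne', le_div_iff₀ hx]
    nlinarith
  exact hxy.trans h

section Softmax

variable {C : Type*} [Fintype C]

theorem softmax_pos (u : C → ℝ) (c : C) : 0 < softmax u c :=
  div_pos (Real.exp_pos _) (sum_pos (fun _ _ => Real.exp_pos _) ⟨c, mem_univ c⟩)

theorem sum_softmax [Nonempty C] (u : C → ℝ) : ∑ c, softmax u c = 1 := by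
  simp only [softmax]
  rw [← sum_div]
  exact div_self (sum_pos (fun _ _ => Real.exp_pos _) univ_nonempty).ne'

theorem softmax_le_one (u : C → ℝ) (c : C) : softmax u c ≤ 1 :=
  haveI : Nonempty C := ⟨c⟩
  (single_le_sum (fun j _ => (softmax_pos u j).le) (mem_univ c)).trans_eq (sum_softmax u)

theorem log_softmax (u : C → ℝ) (c : C) :
    Real.log (softmax u c) = u c - Real.log (∑ j, Real.exp (u j)) := by
  rw [softmax, Real.log_div (Real.exp_pos _).ne'
    (sum_pos (fun _ _ => Real.exp_pos _) ⟨c, mem_univ c⟩).ne', Real.log_exp]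

/-- Softmax is cocoercive: `‖σ(u) - σ(v)‖² ≤ ⟪σ(u) - σ(v), u - v⟫`. -/
theorem sum_sq_softmax_sub_le [Nonempty C] (u v : C → ℝ) :
    ∑ c, (softmax u c - softmax v c) ^ 2 ≤ ∑ c, (softmax u c - softmax v c) * (u c - v c) := by
  set a := Real.log (∑ j, Real.exp (u j))
  set b := Real.log (∑ j, Real.exp (v j))
  calc ∑ c, (softmax u c - softmax v c) ^ 2
      ≤ ∑ c, (softmax u c - softmax v c) * (Real.log (softmax u c) - Real.log (softmax v c)) :=
        sum_le_sum fun c _ => sq_sub_le_sub_mul_log_sub_log (softmax_pos u c) (softmax_le_one u c)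
          (softmax_pos v c) (softmax_le_one v c)
    _ = ∑ c, ((softmax u c - softmax v c) * (u c - v c)
          - (a - b) * (softmax u c - softmax v c)) :=
        sum_congr rfl fun c _ => by rw [log_softmax, log_softmax]; ring
    _ = ∑ c, (softmax u c - softmax v c) * (u c - v c) := by
        rw [sum_sub_distrib, ← mul_sum, sum_sub_distrib, sum_softmax, sum_softmax]
        ring

theorem sqrt_sum_sq_softmax_sub_le [Nonempty C] (u v : C → ℝ) :
    √(∑ c, (softmax u c - softmax v c) ^ 2) ≤ √(∑ c, (u c - v c) ^ 2) := by
  have h := (sum_sq_softmax_sub_le u v).trans (Real.sum_mul_le_sqrt_mul_sqrt _ _ _)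
  rcases (Real.sqrt_nonneg (∑ c, (softmax u c - softmax v c) ^ 2)).eq_or_lt with h0 | h0
  · exact h0 ▸ Real.sqrt_nonneg _
  · refine le_of_mul_le_mul_left ?_ h0
    rwa [Real.mul_self_sqrt (sum_nonneg fun _ _ => sq_nonneg _)]

theorem abs_entropy_sub_le {δ : ℝ} (hδ : 0 < δ) {p q : C → ℝ} (hp : ∀ c, δ ≤ p c)
    (hp1 : ∀ c, p c ≤ 1) (hq : ∀ c, δ ≤ q c) (hq1 : ∀ c, q c ≤ 1) :
    |entropy p - entropy q| ≤
      √(Fintype.card C) * (|Real.log δ| + 1) * √(∑ c, (p c - q c) ^ 2) := by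
  calc |entropy p - entropy q|
      = |∑ c, (p c * Real.log (p c) - q c * Real.log (q c))| := by
        rw [sum_sub_distrib, ← abs_neg, entropy, entropy]
        ring_nf
    _ ≤ ∑ c, |p c * Real.log (p c) - q c * Real.log (q c)| := abs_sum_le_sum_abs _ _
    _ ≤ ∑ c, (|Real.log δ| + 1) * |p c - q c| := sum_le_sum fun c _ =>
        abs_mul_log_sub_mul_log_le hδ (hp c) (hp1 c) (hq c) (hq1 c)
    _ = (|Real.log δ| + 1) * ∑ c, 1 * |p c - q c| := by simp [mul_sum]
    _ ≤ (|Real.log δ| + 1) * (√(∑ _c : C, 1 ^ 2) * √(∑ c, |p c - q c| ^ 2)) := by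
        gcongr
        exact Real.sum_mul_le_sqrt_mul_sqrt _ _ _
    _ = √(Fintype.card C) * (|Real.log δ| + 1) * √(∑ c, (p c - q c) ^ 2) := by
        simp only [sq_abs, one_pow, sum_const, card_univ, nsmul_eq_mul, mul_one]
        ring

theorem abs_entropy_softmax_sub_le [Nonempty C] {δ : ℝ} (hδ : 0 < δ) (u v : EuclideanSpace ℝ C)
    (hu : ∀ c, δ ≤ softmax u c) (hv : ∀ c, δ ≤ softmax v c) :
    |entropy (softmax u) - entropy (softmax v)| ≤
      √(Fintype.card C) * (|Real.log δ| + 1) * ‖u - v‖ := by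
  refine (abs_entropy_sub_le hδ hu (softmax_le_one _) hv (softmax_le_one _)).trans ?_
  rw [EuclideanSpace.norm_eq]
  refine mul_le_mul_of_nonneg_left ?_ (by positivity)
  simpa using sqrt_sum_sq_softmax_sub_le u.ofLp v.ofLp

end Softmax

/-- The descent lemma for a function with Lipschitz gradient. -/
theorem LipschitzWith.apply_add_le_of_gradient {E : Type*} [NormedAddCommGroup E]
    [InnerProductSpace ℝ E] [CompleteSpace E] {Φ : E → ℝ} {ρ : ℝ≥0}
    (hgrad : LipschitzWith ρ (gradient Φ)) (hdiff : Differentiable ℝ Φ) (x w : E) :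
    Φ (x + w) ≤ Φ x + inner ℝ (gradient Φ x) w + ρ / 2 * ‖w‖ ^ 2 := by
  have hderiv (t : ℝ) : HasDerivAt
      (fun t : ℝ => Φ (x + t • w) - t * inner ℝ (gradient Φ x) w - t ^ 2 * (ρ / 2 * ‖w‖ ^ 2))
      (inner ℝ (gradient Φ (x + t • w)) w - inner ℝ (gradient Φ x) w - t * (ρ * ‖w‖ ^ 2)) t := by
    have hline : HasDerivAt (fun t : ℝ => x + t • w) w t := by
      simpa using ((hasDerivAt_id t).smul_const w).const_add x
    have hΦ := (hdiff (x + t • w)).hasGradientAt.hasFDerivAt.comp_hasDerivAt t hline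
    rw [InnerProductSpace.toDual_apply_apply] at hΦ
    have h := (hΦ.sub ((hasDerivAt_id t).mul_const (inner ℝ (gradient Φ x) w))).sub
      (((hasDerivAt_id t).pow 2).mul_const (ρ / 2 * ‖w‖ ^ 2))
    refine h.congr_deriv ?_
    simp only [id_eq]
    push_cast
    ring
  have hanti := antitoneOn_of_deriv_nonpos (convex_Icc (0 : ℝ) 1)
    (fun t _ => (hderiv t).continuousAt.continuousWithinAt)
    (fun t _ => (hderiv t).differentiableAt.differentiableWithinAt) fun t ht => by
      rw [interior_Icc] at ht
      rw [(hderiv t).deriv, ← inner_sub_left, sub_nonpos]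
      calc inner ℝ (gradient Φ (x + t • w) - gradient Φ x) w
          ≤ ‖gradient Φ (x + t • w) - gradient Φ x‖ * ‖w‖ := real_inner_le_norm _ _
        _ ≤ ρ * ‖x + t • w - x‖ * ‖w‖ := by gcongr; exact hgrad.norm_sub_le _ _
        _ = t * (ρ * ‖w‖ ^ 2) := by
            rw [add_sub_cancel_left, norm_smul, Real.norm_of_nonneg ht.1.le]
            ring
  have h := hanti (Set.left_mem_Icc.2 zero_le_one) (Set.right_mem_Icc.2 zero_le_one) zero_le_one
  simp only [one_smul, zero_smul, add_zero] at h
  linarith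

/-- One step of gradient descent with separate step sizes on the two blocks decreases the
objective. -/
theorem mul_sq_norm_gradient_le_sub {E F : Type*} [NormedAddCommGroup E] [InnerProductSpace ℝ E]
    [CompleteSpace E] [NormedAddCommGroup F] [InnerProductSpace ℝ F] [CompleteSpace F]
    {Φ : WithLp 2 (E × F) → ℝ} {ρ : ℝ≥0} (hgrad : LipschitzWith ρ (gradient Φ))
    (hdiff : Differentiable ℝ Φ) {a b : ℝ} (hab : 0 < min a b) (x : WithLp 2 (E × F)) :
    (min a b - ρ * max a b ^ 2 / 2) * ‖gradient Φ x‖ ^ 2 ≤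
      Φ x - Φ (WithLp.toLp 2
        (x.fst - a • (gradient Φ x).fst, x.snd - b • (gradient Φ x).snd)) := by
  set v := gradient Φ x
  have ha : 0 < a := hab.trans_le (min_le_left _ _)
  have hb : 0 < b := hab.trans_le (min_le_right _ _)
  set w : WithLp 2 (E × F) := WithLp.toLp 2 (-(a • v.fst), -(b • v.snd)) with hw
  have hxw : WithLp.toLp 2 (x.fst - a • v.fst, x.snd - b • v.snd) = x + w := by
    apply WithLp.ofLp_injective
    ext <;> simp [hw, sub_eq_add_neg]
  have h := hgrad.apply_add_le_of_gradient hdiff x w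
  have hinner : inner ℝ v w = -(a * ‖v.fst‖ ^ 2 + b * ‖v.snd‖ ^ 2) := by
    simp [hw, WithLp.prod_inner_apply, inner_neg_right, real_inner_smul_right]
    ring
  have hnormw : ‖w‖ ^ 2 = a ^ 2 * ‖v.fst‖ ^ 2 + b ^ 2 * ‖v.snd‖ ^ 2 := by
    simp [hw, WithLp.prod_norm_sq_eq_of_L2, norm_smul, mul_pow]
  have hmin : min a b * ‖v‖ ^ 2 ≤ a * ‖v.fst‖ ^ 2 + b * ‖v.snd‖ ^ 2 := by
    rw [WithLp.prod_norm_sq_eq_of_L2, mul_add]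
    gcongr
    exacts [min_le_left _ _, min_le_right _ _]
  have hmax : a ^ 2 * ‖v.fst‖ ^ 2 + b ^ 2 * ‖v.snd‖ ^ 2 ≤ max a b ^ 2 * ‖v‖ ^ 2 := by
    rw [WithLp.prod_norm_sq_eq_of_L2, mul_add]
    gcongr
    exacts [le_max_left _ _, le_max_right _ _]
  have hmaxρ := mul_le_mul_of_nonneg_left hmax (by positivity : (0 : ℝ) ≤ ρ / 2)
  rw [hxw]
  rw [hinner, hnormw] at h
  linarith

/-- (Theorem 1(1), quantitative form: the online-branch entropy change strictly
dominates the target-branch entropy change.)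
With `G(θ_f) = H(σ(g(f θ_f)))` the target-branch entropy, `Φ` the online objective
(differentiable with `ρ`-Lipschitz gradient), blockwise update
`θ_h' = θ_h − η_h • v_h`, `θ_f' = θ_f − η_f • v_f` where `(v_h, v_f) = ∇Φ(φt)`,
`η_min = min(η_h, η_f) > 0`, `η_max = max(η_h, η_f)`, `η_min − ρ·η_max²/2 > 0`:
if both softmax predictions are `δ`-interior and
`‖∇Φ(φt)‖ > √n · (|log δ| + 1) · ‖g‖ · L_f · η_max / (η_min − ρ·η_max²/2)`, then
`Φ(φt) − Φ(φt1) > |G(θ_f') − G(θ_f)|`. -/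
theorem online_entropy_change_dominates_target {k m d : ℕ} {C : Type*} [Fintype C] [Nonempty C]
    (n : ℕ) (hn : Fintype.card C = n)
    (δ : ℝ) (hδ0 : 0 < δ) (hδ1 : δ ≤ 1)
    (ηh ηf : ℝ)
    (Lf : ℝ≥0) (hLf : 0 < Lf)
    (f : EuclideanSpace ℝ (Fin m) → EuclideanSpace ℝ (Fin d))
    (hf : LipschitzWith Lf f)
    (g : EuclideanSpace ℝ (Fin d) →L[ℝ] EuclideanSpace ℝ C)
    (Φ : WithLp 2 (EuclideanSpace ℝ (Fin k) × EuclideanSpace ℝ (Fin m)) → ℝ)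
    (ρ : ℝ≥0) (hρ : 0 < ρ)
    (hΦdiff : Differentiable ℝ Φ)
    (hΦgrad : LipschitzWith ρ (gradient Φ))
    (θh : EuclideanSpace ℝ (Fin k)) (θf : EuclideanSpace ℝ (Fin m))
    (φt : WithLp 2 (EuclideanSpace ℝ (Fin k) × EuclideanSpace ℝ (Fin m)))
    (hφt : φt = (WithLp.equiv 2 _).symm (θh, θf))
    (vh : EuclideanSpace ℝ (Fin k)) (vf : EuclideanSpace ℝ (Fin m))
    (hv : (vh, vf) = (WithLp.equiv 2 _) (gradient Φ φt))
    (θh' : EuclideanSpace ℝ (Fin k)) (θf' : EuclideanSpace ℝ (Fin m))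
    (hθh' : θh' = θh - ηh • vh)
    (hθf' : θf' = θf - ηf • vf)
    (φt1 : WithLp 2 (EuclideanSpace ℝ (Fin k) × EuclideanSpace ℝ (Fin m)))
    (hφt1 : φt1 = (WithLp.equiv 2 _).symm (θh', θf'))
    (ηmin ηmax : ℝ)
    (hηmin : ηmin = min ηh ηf) (hηmax : ηmax = max ηh ηf)
    (hηminpos : 0 < ηmin)
    (hstep : 0 < ηmin - (ρ : ℝ) * ηmax ^ 2 / 2)
    (hδt : ∀ c, δ ≤ softmax (g (f θf)) c)
    (hδt' : ∀ c, δ ≤ softmax (g (f θf')) c)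
    (hbig : ‖gradient Φ φt‖ >
      Real.sqrt n * (|Real.log δ| + 1) * ‖g‖ * (Lf : ℝ) * ηmax /
        (ηmin - (ρ : ℝ) * ηmax ^ 2 / 2)) :
    Φ φt - Φ φt1 >
      |entropy (softmax (g (f θf'))) - entropy (softmax (g (f θf)))| := by
  subst hn hφt hθh' hθf' hφt1 hηmin hηmax
  set x : WithLp 2 (EuclideanSpace ℝ (Fin k) × EuclideanSpace ℝ (Fin m)) :=
    (WithLp.equiv 2 _).symm (θh, θf)
  set v := gradient Φ x
  obtain rfl : vh = v.fst := congrArg Prod.fst hv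
  obtain rfl : vf = v.snd := congrArg Prod.snd hv
  have hηf : 0 < ηf := hηminpos.trans_le (min_le_right _ _)
  have hηmax : 0 < max ηh ηf := hηf.trans_le (le_max_right _ _)
  have hdescent := mul_sq_norm_gradient_le_sub hΦgrad hΦdiff hηminpos x
  have hmove : ‖g (f (θf - ηf • v.snd)) - g (f θf)‖ ≤ ‖g‖ * (Lf * (max ηh ηf * ‖v‖)) := by
    rw [← map_sub]
    refine (g.le_opNorm _).trans ?_
    gcongr
    refine (hf.norm_sub_le _ _).trans ?_
    rw [sub_sub_cancel_left, norm_neg, norm_smul, Real.norm_of_nonneg hηf.le]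
    gcongr
    exacts [le_max_right _ _, WithLp.norm_snd_le _ v]
  have hv0 : 0 < ‖v‖ := lt_of_le_of_lt (by positivity) hbig
  rw [gt_iff_lt, div_lt_iff₀ hstep] at hbig
  calc |entropy (softmax (g (f (θf - ηf • v.snd)))) - entropy (softmax (g (f θf)))|
      ≤ √(Fintype.card C) * (|Real.log δ| + 1) * ‖g (f (θf - ηf • v.snd)) - g (f θf)‖ :=
        abs_entropy_softmax_sub_le hδ0 _ _ hδt' hδt
    _ ≤ √(Fintype.card C) * (|Real.log δ| + 1) * (‖g‖ * (Lf * (max ηh ηf * ‖v‖))) := by gcongr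
    _ = √(Fintype.card C) * (|Real.log δ| + 1) * ‖g‖ * Lf * max ηh ηf * ‖v‖ := by ring
    _ < ‖v‖ * (min ηh ηf - ρ * max ηh ηf ^ 2 / 2) * ‖v‖ := by gcongr
    _ = (min ηh ηf - ρ * max ηh ηf ^ 2 / 2) * ‖v‖ ^ 2 := by ring
    _ ≤ _ := hdescent
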